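/- For every monomial τ = t^{k_0} t_1^{k_1} ⋯ t_m^{k_m} ∈ Λ^{aug} with m ≤ n−1 and every w ∈ H_n(q), there exist finitely many monomials λ_j ∈ Λ and elements w_j ∈ H_n(q) such that τ · w ≐ Σ_j λ_j w_j in H_{1,n}(q), i.e. τ·w − Σ_j λ_j w_j lies in the R-submodule of H_{1,n}(q) spanned by all commutators ab − ba (a, b ∈ H_{1,n}(q)). -/

import Mathlib

set_option synthInstance.maxHeartbeats 1000000
set_option maxHeartbeats 2000000

namespace MB

/-! ## The mixed braid group `B_{1,n}` (with `m = n - 1` braiding generators) -/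

/-- Generators: `none` is the looping generator `t`, `some i` is `σ_{i+1}` for `i : Fin m`. -/
abbrev MBGen (m : ℕ) := Option (Fin m)

/-- The relators of the mixed braid group `B_{1,n}` (`m = n-1`):
`σ₁tσ₁t = tσ₁tσ₁`; `tσ_i = σ_i t` for `i > 1`; the braid relations among the `σ_i`. -/
def rels (m : ℕ) : Set (FreeGroup (MBGen m)) :=
  { r | (∃ h : 0 < m,
          r = (FreeGroup.of (some ⟨0, h⟩) * FreeGroup.of none) ^ 2 *
              ((FreeGroup.of (none : MBGen m) * FreeGroup.of (some ⟨0, h⟩)) ^ 2)⁻¹) ∨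
        (∃ i : Fin m, 1 ≤ (i : ℕ) ∧
          r = FreeGroup.of (none : MBGen m) * FreeGroup.of (some i) *
              (FreeGroup.of (some i) * FreeGroup.of (none : MBGen m))⁻¹) ∨
        (∃ i j : Fin m, (i : ℕ) + 1 = (j : ℕ) ∧
          r = FreeGroup.of (some i) * FreeGroup.of (some j) * FreeGroup.of (some i) *
              (FreeGroup.of (some j) * FreeGroup.of (some i) * FreeGroup.of (some j))⁻¹) ∨
        (∃ i j : Fin m, (i : ℕ) + 1 < (j : ℕ) ∧
          r = FreeGroup.of (some i) * FreeGroup.of (some j) *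
              (FreeGroup.of (some j) * FreeGroup.of (some i))⁻¹) }

/-- The mixed braid group `B_{1,n}` with `n = m+1` moving strands. -/
abbrev B (m : ℕ) := PresentedGroup (rels m)

/-- The braiding generator `σ_{i+1}`, for `i : Fin m`. -/
def σ {m : ℕ} (i : Fin m) : B m := PresentedGroup.of (some i)

/-- The looping generator `t`. -/
def τ {m : ℕ} : B m := PresentedGroup.of none

/-- `σ_j` in one-based indexing (`1 ≤ j ≤ m`), junk value `1` out of range. -/
def sig {m : ℕ} (j : ℕ) : B m :=
  if h : 1 ≤ j ∧ j - 1 < m then σ ⟨j - 1, h.2⟩ else 1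

/-- The looping elements `t_i = σ_i ⋯ σ_1 t σ_1 ⋯ σ_i` (for `0 ≤ i ≤ m`), via `t_0 = t`,
`t_{j+1} = σ_{j+1} t_j σ_{j+1}`. -/
def tt {m : ℕ} : ℕ → B m
  | 0 => τ
  | (j+1) => sig (j+1) * tt j * sig (j+1)

/-- The looping elements `t′_i = σ_i ⋯ σ_1 t σ_1⁻¹ ⋯ σ_i⁻¹` (for `0 ≤ i ≤ m`), via `t′_0 = t`,
`t′_{j+1} = σ_{j+1} t′_j σ_{j+1}⁻¹`. -/
def tp {m : ℕ} : ℕ → B m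
  | 0 => τ
  | (j+1) => sig (j+1) * tp j * (sig (j+1))⁻¹

/-! ## The generalized Iwahori–Hecke algebra of type B, `H_{1,n}(q)` -/

/-- The ground ring `R = ℂ[q^{±1}]` of Laurent polynomials. -/
abbrev R : Type := LaurentPolynomial ℂ

instance : IsDomain R := NoZeroDivisors.to_isDomain _

/-- The variable `q ∈ R`. -/
noncomputable def qq : R := LaurentPolynomial.T 1

/-- The quadratic Hecke relations `σ_i² = (q-1)σ_i + q`. -/
inductive heckeRel (m : ℕ) :
    MonoidAlgebra R (B m) → MonoidAlgebra R (B m) → Prop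
  | quad (i : Fin m) : heckeRel m
      (MonoidAlgebra.of R (B m) (σ i) * MonoidAlgebra.of R (B m) (σ i))
      ((qq - 1) • MonoidAlgebra.of R (B m) (σ i) + qq • (1 : MonoidAlgebra R (B m)))

/-- The generalized Iwahori–Hecke algebra of type B, `H_{1,n}(q)` (`n = m+1`), as the quotient
of the group algebra `R[B_{1,n}]` by the two-sided ideal generated by the quadratic relations. -/
abbrev H (m : ℕ) := RingQuot (heckeRel m)

/-- The canonical multiplicative map `π : B_{1,n} → H_{1,n}(q)`. -/
noncomputable def pih (m : ℕ) : B m →* H m :=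
  (RingQuot.mkRingHom (heckeRel m)).toMonoidHom.comp (MonoidAlgebra.of R (B m))

/-- The subalgebra `H_n(q)` of `H_{1,n}(q)` generated by the images `g_1, …, g_{n-1}`
of `σ_1, …, σ_{n-1}`. -/
noncomputable def HA (m : ℕ) : Subalgebra R (H m) :=
  Algebra.adjoin R (Set.range fun i : Fin m => pih m (σ i))

/-- The monomial `t^{k_0} t_1^{k_1} ⋯ t_{ℓ-1}^{k_{ℓ-1}}` with consecutive indices
(an element of `Λ^{aug}` when all exponents are nonzero). -/
def augWord {m : ℕ} (ℓ : ℕ) (k : Fin ℓ → ℤ) : B m :=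
  (List.ofFn fun j => tt (j : ℕ) ^ k j).prod

section Helpers

open Finset

/-! ### Relations in the mixed braid group -/

lemma rel_eq {m : ℕ} {x y : FreeGroup (MBGen m)} (h : x * y⁻¹ ∈ rels m) :
    PresentedGroup.mk (rels m) x = PresentedGroup.mk (rels m) y := by
  have h1 := PresentedGroup.one_of_mem h
  rw [map_mul, map_inv, mul_inv_eq_one] at h1
  exact h1

lemma sig_in {m j : ℕ} (h : j < m) : (sig (j+1) : B m) = σ ⟨j, h⟩ := by
  simp [sig, h]

lemma sig_out {m j : ℕ} (h : m ≤ j) : (sig (j+1) : B m) = 1 := by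
  simp [sig, h]

lemma sig_zero {m : ℕ} : (sig 0 : B m) = 1 := by simp [sig]

lemma sig_comm_far {m i j : ℕ} (h : i + 1 < j) : Commute (sig i : B m) (sig j) := by
  rcases i with _ | i
  · rw [sig_zero]; exact Commute.one_left _
  rcases j with _ | j
  · omega
  by_cases hj : j < m
  · rw [sig_in hj, sig_in (show i < m by omega)]
    have h1 := @rel_eq m (FreeGroup.of (some ⟨i, by omega⟩) * FreeGroup.of (some ⟨j, hj⟩))
      (FreeGroup.of (some ⟨j, hj⟩) * FreeGroup.of (some ⟨i, by omega⟩))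
      (Or.inr (Or.inr (Or.inr ⟨⟨i, by omega⟩, ⟨j, hj⟩, by simp; omega, rfl⟩)))
    exact h1
  · rw [sig_out (show m ≤ j by omega)]; exact Commute.one_right _

lemma sig_braid {m i : ℕ} (h : i + 1 < m) :
    (sig (i+1) : B m) * sig (i+2) * sig (i+1) = sig (i+2) * sig (i+1) * sig (i+2) := by
  rw [sig_in h, sig_in (show i < m by omega)]
  have h1 := @rel_eq m (FreeGroup.of (some ⟨i, by omega⟩) * FreeGroup.of (some ⟨i+1, h⟩)
      * FreeGroup.of (some ⟨i, by omega⟩))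
      (FreeGroup.of (some ⟨i+1, h⟩) * FreeGroup.of (some ⟨i, by omega⟩)
      * FreeGroup.of (some ⟨i+1, h⟩))
      (Or.inr (Or.inr (Or.inl ⟨⟨i, by omega⟩, ⟨i+1, h⟩, rfl, rfl⟩)))
  exact h1

lemma sig_comm_t {m j : ℕ} (h : 2 ≤ j) : Commute (sig j : B m) τ := by
  obtain ⟨j, rfl⟩ : ∃ i, j = i + 1 := ⟨j - 1, by omega⟩
  by_cases hj : j < m
  · rw [sig_in hj]
    have h1 := @rel_eq m (FreeGroup.of none * FreeGroup.of (some ⟨j, hj⟩))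
      (FreeGroup.of (some ⟨j, hj⟩) * FreeGroup.of none)
      (Or.inr (Or.inl ⟨⟨j, hj⟩, by simp; omega, rfl⟩))
    exact Eq.symm h1
  · rw [sig_out (show m ≤ j by omega)]; exact Commute.one_left _

lemma t_comm_one {m : ℕ} (h : 0 < m) : Commute (τ : B m) (tt 1) := by
  have h1 := @rel_eq m ((FreeGroup.of (some ⟨0, h⟩) * FreeGroup.of none) ^ 2)
      ((FreeGroup.of none * FreeGroup.of (some ⟨0, h⟩)) ^ 2)
      (Or.inl ⟨h, rfl⟩)
  have h2 : ((σ ⟨0, h⟩ : B m) * τ) ^ 2 = (τ * σ ⟨0, h⟩) ^ 2 := h1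
  show τ * (sig (0+1) * τ * sig (0+1)) = (sig (0+1) * τ * sig (0+1)) * τ
  rw [sig_in h]
  simp only [pow_two, mul_assoc] at h2 ⊢
  exact h2.symm

lemma sig_comm_tt_hi {m j : ℕ} : ∀ i : ℕ, i + 2 ≤ j → Commute (sig j : B m) (tt i)
  | 0, h => sig_comm_t h
  | i+1, h => by
    have h1 := sig_comm_tt_hi (m := m) (j := j) i (by omega)
    have h2 : Commute (sig j : B m) (sig (i+1)) := (sig_comm_far (by omega)).symm
    exact (h2.mul_right h1).mul_right h2

lemma sig_comm_tt_lo {m j : ℕ} : ∀ i : ℕ, i ≤ m → j < i → Commute (sig j : B m) (tt i)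
  | 0, _, h => by omega
  | i+1, hi, h => by
    rcases Nat.lt_or_ge j i with hj | hj
    · have h1 := sig_comm_tt_lo (m := m) (j := j) i (by omega) hj
      have h2 : Commute (sig j : B m) (sig (i+1)) := sig_comm_far (by omega)
      exact (h2.mul_right h1).mul_right h2
    · obtain rfl : j = i := by omega
      rcases j with _ | j
      · rw [sig_zero]; exact Commute.one_left _
      have hb := sig_braid (m := m) (i := j) (by omega)
      have hc : sig (j+2) * tt j = tt j * (sig (j+2) : B m) := sig_comm_tt_hi j le_rfl
      show sig (j+1) * (sig (j+2) * (sig (j+1) * tt j * sig (j+1)) * sig (j+2))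
        = (sig (j+2) * (sig (j+1) * tt j * sig (j+1)) * sig (j+2)) * sig (j+1)
      calc sig (j+1) * (sig (j+2) * (sig (j+1) * tt j * sig (j+1)) * sig (j+2))
          = (sig (j+1) * sig (j+2) * sig (j+1)) * tt j * sig (j+1) * sig (j+2) := by
            simp only [mul_assoc]
        _ = sig (j+2) * sig (j+1) * (sig (j+2) * tt j) * sig (j+1) * sig (j+2) := by
            rw [hb]; simp only [mul_assoc]
        _ = sig (j+2) * sig (j+1) * tt j * (sig (j+2) * sig (j+1) * sig (j+2)) := by
            rw [hc]; simp only [mul_assoc]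
        _ = _ := by rw [← hb]; simp only [mul_assoc]

lemma tt_comm_zero {m : ℕ} : ∀ j : ℕ, j + 1 ≤ m → Commute (τ : B m) (tt (j+1))
  | 0, h => t_comm_one h
  | j+1, h => by
    have h1 := tt_comm_zero (m := m) j (by omega)
    have h2 : Commute (τ : B m) (sig (j+2)) := (sig_comm_t (by omega)).symm
    exact (h2.mul_right h1).mul_right h2

lemma tt_comm_lt {m j : ℕ} (hj : j ≤ m) : ∀ i : ℕ, i < j → Commute (tt i : B m) (tt j)
  | 0, h => by
    obtain ⟨j, rfl⟩ : ∃ i, j = i + 1 := ⟨j - 1, by omega⟩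
    exact tt_comm_zero j hj
  | i+1, h => by
    have h1 := tt_comm_lt hj i (by omega)
    have h2 : Commute (sig (i+1) : B m) (tt j) := sig_comm_tt_lo j hj h
    exact (h2.mul_left h1).mul_left h2

lemma tt_comm {m i j : ℕ} (hi : i ≤ m) (hj : j ≤ m) : Commute (tt i : B m) (tt j) := by
  rcases lt_trichotomy i j with h | rfl | h
  · exact tt_comm_lt hj i h
  · exact Commute.refl _
  · exact (tt_comm_lt hi j h).symm

/-! ### Monomials in the looping elements -/

/-- The monomial `t_0^{a_0} ⋯ t_{n-1}^{a_{n-1}}`. -/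
def PP {m : ℕ} (a : ℕ → ℤ) : ℕ → B m
  | 0 => 1
  | n+1 => PP a n * tt n ^ a n

/-- Replace the exponents at `i` and `i+1`. -/
def sw (a : ℕ → ℤ) (i : ℕ) (c d : ℤ) : ℕ → ℤ :=
  fun j => if j = i then c else if j = i + 1 then d else a j

lemma PP_congr {m : ℕ} {a b : ℕ → ℤ} : ∀ n : ℕ, (∀ j < n, a j = b j) →
    (PP a n : B m) = PP b n
  | 0, _ => rfl
  | n+1, h => by
    rw [PP, PP, PP_congr n (fun j hj => h j (by omega)), h n (by omega)]

lemma PP_zero {m : ℕ} {a : ℕ → ℤ} (l : ℕ) : ∀ n : ℕ, l ≤ n →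
    (∀ j, l ≤ j → j < n → a j = 0) → (PP a n : B m) = PP a l := by
  intro n hn
  induction n, hn using Nat.le_induction with
  | base => intro _; rfl
  | succ n hn ih =>
    intro h
    rw [PP, ih (fun j h1 h2 => h j h1 (by omega)), h n hn (by omega), zpow_zero, mul_one]

lemma augWord_eq {m : ℕ} (a : ℕ → ℤ) (l : ℕ) :
    (augWord l (fun j : Fin l => a j) : B m) = PP a l := by
  induction l with
  | zero => simp [augWord, PP]
  | succ n ih =>
    rw [PP, ← ih]
    rw [augWord, List.ofFn_succ', List.concat_eq_append, List.prod_append, List.prod_singleton]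
    rfl

lemma sw_self (a : ℕ → ℤ) (i : ℕ) : sw a i (a i) (a (i+1)) = a := by
  funext j
  simp only [sw]
  split_ifs with h1 h2
  · rw [h1]
  · rw [h2]
  · rfl

lemma PP_sw {m : ℕ} (a : ℕ → ℤ) (i : ℕ) (c d : ℤ) : ∀ n : ℕ, i + 1 < n → n ≤ m + 1 →
    (PP (sw a i c d) n : B m) = PP (sw a i 0 0) n * (tt i ^ c * tt (i+1) ^ d)
  | 0, h, _ => by omega
  | n+1, h, hn => by
    rcases Nat.lt_or_ge (i+1) n with h1 | h1
    · have e1 : sw a i c d n = a n := by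
        simp only [sw]; rw [if_neg (by omega), if_neg (by omega)]
      have e2 : sw a i 0 0 n = a n := by
        simp only [sw]; rw [if_neg (by omega), if_neg (by omega)]
      rw [PP, PP, PP_sw a i c d n h1 (by omega), e1, e2]
      have hc : Commute (tt n ^ a n : B m) (tt i ^ c * tt (i+1) ^ d) :=
        (((tt_comm (by omega) (by omega)).zpow_zpow _ _).mul_right
          ((tt_comm (by omega) (by omega)).zpow_zpow _ _))
      rw [mul_assoc, mul_assoc (PP (sw a i 0 0) n) (tt n ^ a n), hc.eq]
    · obtain rfl : n = i + 1 := by omega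
      have e : (PP (sw a i c d) i : B m) = PP (sw a i 0 0) i := by
        apply PP_congr
        intro j hj
        simp only [sw]
        rw [if_neg (by omega), if_neg (by omega), if_neg (by omega), if_neg (by omega)]
      simp only [PP]
      rw [e]
      simp [sw, mul_assoc]

lemma sig_comm_PP {m : ℕ} (a : ℕ → ℤ) (i : ℕ) : ∀ n : ℕ, n ≤ m + 1 →
    Commute (sig (i+1) : B m) (PP (sw a i 0 0) n)
  | 0, _ => Commute.one_right _
  | n+1, hn => by
    refine (sig_comm_PP a i n (by omega)).mul_right ?_
    by_cases h1 : n = i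
    · simp [sw, h1]
    by_cases h2 : n = i + 1
    · simp [sw, h2]
    apply Commute.zpow_right
    rcases Nat.lt_or_ge n i with h | h
    · exact sig_comm_tt_hi n (by omega)
    · exact sig_comm_tt_lo n (by omega) (by omega)

lemma sig_comm_xy {m i : ℕ} (hi : i < m) : Commute (sig (i+1) : B m) (tt i * tt (i+1)) := by
  have h : tt (i+1) = sig (i+1) * tt i * (sig (i+1) : B m) := rfl
  have hc : tt i * tt (i+1) = tt (i+1) * (tt i : B m) := tt_comm (by omega) (by omega)
  show sig (i+1) * (tt i * tt (i+1)) = tt i * tt (i+1) * sig (i+1)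
  calc sig (i+1) * (tt i * tt (i+1)) = sig (i+1) * tt i * sig (i+1) * tt i * sig (i+1) := by
        rw [h]; simp only [mul_assoc]
    _ = tt (i+1) * tt i * sig (i+1) := by rw [h]
    _ = _ := by rw [hc]

lemma sum_sw (F : ℕ → ℤ → ℕ) (a : ℕ → ℤ) (i : ℕ) (c d : ℤ) : ∀ n : ℕ, i + 1 < n →
    (∑ j ∈ range n, F j (sw a i c d j)) + F i (a i) + F (i+1) (a (i+1))
      = (∑ j ∈ range n, F j (a j)) + F i c + F (i+1) d
  | 0, h => by omega
  | n+1, h => by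
    rw [sum_range_succ, sum_range_succ]
    rcases Nat.lt_or_ge (i+1) n with h1 | h1
    · have e1 : sw a i c d n = a n := by
        simp only [sw]; rw [if_neg (by omega), if_neg (by omega)]
      have := sum_sw F a i c d n h1
      rw [e1]; omega
    · obtain rfl : n = i + 1 := by omega
      rw [sum_range_succ, sum_range_succ]
      have e : ∑ j ∈ range i, F j (sw a i c d j) = ∑ j ∈ range i, F j (a j) := by
        apply sum_congr rfl
        intro j hj
        have := mem_range.1 hj
        simp only [sw]
        rw [if_neg (by omega), if_neg (by omega)]
      rw [e]
      simp [sw]; omega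

/-! ### Hecke algebra facts -/

lemma qq_mul : (LaurentPolynomial.T (-1) : R) * qq = 1 := by
  rw [qq, ← LaurentPolynomial.T_add]; simp

lemma quad {m i : ℕ} (hi : i < m) :
    pih m (sig (i+1)) * pih m (sig (i+1))
      = (qq - 1) • pih m (sig (i+1)) + qq • (1 : H m) := by
  rw [sig_in hi]
  have h := RingQuot.mkAlgHom_rel R (heckeRel.quad (m := m) ⟨i, hi⟩)
  rw [map_mul, map_add, map_smul, map_smul, map_one] at h
  have e : ∀ x, RingQuot.mkAlgHom R (heckeRel m) x = RingQuot.mkRingHom (heckeRel m) x := by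
    intro x
    rw [← RingQuot.mkAlgHom_coe R (heckeRel m)]; rfl
  rw [e] at h
  exact h

lemma g_mem {m i : ℕ} (hi : i < m) : pih m (sig (i+1)) ∈ HA m := by
  rw [sig_in hi]
  exact Algebra.subset_adjoin ⟨⟨i, hi⟩, rfl⟩

lemma g_inv_mul {m : ℕ} (s : B m) : pih m s⁻¹ * pih m s = 1 := by
  rw [← map_mul, inv_mul_cancel, map_one]

lemma g_mul_inv {m : ℕ} (s : B m) : pih m s * pih m s⁻¹ = 1 := by
  rw [← map_mul, mul_inv_cancel, map_one]

lemma g_eq {m i : ℕ} (hi : i < m) :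
    pih m (sig (i+1)) = qq • pih m (sig (i+1))⁻¹ + (qq - 1) • (1 : H m) := by
  have h := congrArg (fun x => x * pih m (sig (i+1))⁻¹) (quad hi)
  simp only [add_mul, smul_mul_assoc, mul_assoc, g_mul_inv, mul_one, one_mul] at h
  rw [h, add_comm]

lemma g_inv_eq {m i : ℕ} (hi : i < m) :
    pih m (sig (i+1))⁻¹ = (LaurentPolynomial.T (-1) : R) • pih m (sig (i+1))
      + (-(LaurentPolynomial.T (-1) : R) * (qq - 1)) • (1 : H m) := by
  conv_rhs => rw [g_eq hi]
  rw [smul_add, smul_smul, qq_mul, one_smul, smul_smul, add_assoc, ← add_smul,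
    neg_mul, add_neg_cancel, zero_smul, add_zero]

lemma g_inv_mem {m i : ℕ} (hi : i < m) : pih m (sig (i+1))⁻¹ ∈ HA m := by
  rw [g_inv_eq hi]
  exact add_mem (Subalgebra.smul_mem _ (g_mem hi) _) (Subalgebra.smul_mem _ (one_mem _) _)

lemma H_sub_add {m : ℕ} (x y : H m) : x - y + y = x := sub_add_cancel x y

lemma span_map_mem {A : Type*} [Semiring A] [Algebra R A] (φ : A →ₗ[R] A) (S : Set A)
    (L : Submodule R A) (h : ∀ z ∈ S, φ z ∈ L) {u : A} (hu : u ∈ Submodule.span R S) :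
    φ u ∈ L :=
  (Submodule.span_le.2 h : Submodule.span R S ≤ L.comap φ) hu

/-- The key straightening lemma, in abstract form. -/
lemma straighten {A : Type*} [Ring A] [Algebra R A] (S : Subalgebra R A) (x y u v : A)
    (α β : R) (hux : u * x = y * v) (hv : v = α • u + β • 1) (hxy : x * y = y * x)
    (hvS : v ∈ S) (k : ℕ) :
    u * x ^ (k+1) ∈ Submodule.span R
      {z | ∃ j, j < k + 1 ∧ ∃ h ∈ S, z = x ^ j * y ^ (k+1-j) * h} := by
  induction k with
  | zero =>
    apply Submodule.subset_span
    exact ⟨0, by omega, v, hvS, by simpa using hux⟩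
  | succ k ih =>
    have e : u * x ^ (k+1+1) = α • (y * (u * x ^ (k+1))) + β • (x ^ (k+1) * y) := by
      have hc : x ^ (k+1) * y = y * x ^ (k+1) := (Commute.pow_left hxy (k+1)).eq
      rw [pow_succ' x (k+1), ← mul_assoc, hux, hv, hc]
      simp only [mul_add, add_mul, mul_smul_comm, smul_mul_assoc, mul_one, mul_assoc]
    rw [e]
    refine add_mem (Submodule.smul_mem _ _ ?_) (Submodule.smul_mem _ _ ?_)
    · have hle : Submodule.span R {z | ∃ j, j < k + 1 ∧ ∃ h ∈ S, z = x ^ j * y ^ (k+1-j) * h}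
          ≤ (Submodule.span R {z | ∃ j, j < k + 1 + 1 ∧ ∃ h ∈ S,
            z = x ^ j * y ^ (k+1+1-j) * h}).comap (LinearMap.mulLeft R y) := by
        rw [Submodule.span_le]
        rintro z ⟨j, hj, h, hh, rfl⟩
        apply Submodule.subset_span
        refine ⟨j, by omega, h, hh, ?_⟩
        have hc : x ^ j * y = y * x ^ j := (Commute.pow_left hxy j).eq
        rw [LinearMap.mulLeft_apply, show k+1+1-j = (k+1-j)+1 by omega, pow_succ',
          ← mul_assoc (x ^ j), hc]
        simp only [mul_assoc]
      exact hle ih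
    · apply Submodule.subset_span
      refine ⟨k+1, by omega, 1, one_mem _, ?_⟩
      simp

/-- Straightening of a general two-variable monomial. -/
lemma straighten_xy {m i : ℕ} (hi : i < m) (a b : ℤ) (hab : a ≠ b) :
    ∃ s : B m, (s = sig (i+1) ∨ s = (sig (i+1))⁻¹) ∧
      pih m (s * (tt i ^ a * tt (i+1) ^ b)) ∈ Submodule.span R
        {z | ∃ c d : ℤ, c + d = a + b ∧ ((c = b ∧ d = a) ∨ |c - d| < |a - b|) ∧
          ∃ h ∈ HA m, z = pih m (tt i ^ c * tt (i+1) ^ d) * h} := by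
  have hxy : Commute (tt i : B m) (tt (i+1)) := tt_comm (by omega) (by omega)
  have hgx : sig (i+1) * tt i = tt (i+1) * (sig (i+1) : B m)⁻¹ := by
    show _ = sig (i+1) * tt i * sig (i+1) * (sig (i+1))⁻¹
    simp [mul_assoc]
  have hgy : (sig (i+1) : B m)⁻¹ * tt (i+1) = tt i * sig (i+1) := by
    show (sig (i+1))⁻¹ * (sig (i+1) * tt i * sig (i+1)) = _
    simp [mul_assoc]
  have hcen := sig_comm_xy hi
  have hpow : ∀ b : ℤ, (tt i * tt (i+1) : B m) ^ b = tt i ^ b * tt (i+1) ^ b :=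
    fun b => hxy.mul_zpow b
  rcases lt_or_gt_of_ne hab with h | h
  · refine ⟨(sig (i+1))⁻¹, Or.inr rfl, ?_⟩
    obtain ⟨k, hk⟩ : ∃ k : ℕ, b = a + (k + 1) := ⟨(b - a - 1).toNat, by omega⟩
    have st := straighten (HA m) (pih m (tt (i+1))) (pih m (tt i)) (pih m (sig (i+1))⁻¹)
      (pih m (sig (i+1))) _ _ (by rw [← map_mul, hgy, map_mul]) (g_eq hi)
      (by rw [← map_mul, ← hxy.eq, map_mul]) (g_mem hi) k
    have e : pih m ((sig (i+1))⁻¹ * (tt i ^ a * tt (i+1) ^ b))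
        = pih m ((tt i * tt (i+1)) ^ a) *
          (pih m (sig (i+1))⁻¹ * pih m (tt (i+1)) ^ (k+1)) := by
      rw [← map_pow, ← map_mul, ← map_mul, ← mul_assoc ((tt i * tt (i+1)) ^ a),
        ← ((hcen.inv_left).zpow_right a).eq, hpow, hk, zpow_add]
      congr 1
      simp only [mul_assoc]
      norm_cast
    rw [e]
    refine span_map_mem (LinearMap.mulLeft R (pih m ((tt i * tt (i+1)) ^ a))) _ _ ?_ st
    rintro z ⟨j, hj, h, hh, rfl⟩
    apply Submodule.subset_span
    refine ⟨a + ((k + 1 - j : ℕ) : ℤ), a + j, by omega, ?_, h, hh, ?_⟩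
    · rcases Nat.eq_zero_or_pos j with rfl | hj0
      · left; constructor <;> omega
      · right; simp only [abs_eq_max_neg]; omega
    · rw [LinearMap.mulLeft_apply, ← map_pow, ← map_pow, ← map_mul, ← mul_assoc, ← map_mul]
      congr 2
      rw [hpow, zpow_add, zpow_add, zpow_natCast, zpow_natCast, (hxy.symm.pow_pow _ _).eq]
      have := (hxy.symm.zpow_left a).pow_right (k+1-j)
      rw [mul_assoc, ← mul_assoc (tt (i+1) ^ a), this.eq]
      simp only [mul_assoc]
  · refine ⟨sig (i+1), Or.inl rfl, ?_⟩
    obtain ⟨k, hk⟩ : ∃ k : ℕ, a = b + (k + 1) := ⟨(a - b - 1).toNat, by omega⟩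
    have st := straighten (HA m) (pih m (tt i)) (pih m (tt (i+1))) (pih m (sig (i+1)))
      (pih m (sig (i+1))⁻¹) _ _ (by rw [← map_mul, hgx, map_mul]) (g_inv_eq hi)
      (by rw [← map_mul, hxy.eq, map_mul]) (g_inv_mem hi) k
    have e : pih m (sig (i+1) * (tt i ^ a * tt (i+1) ^ b))
        = pih m ((tt i * tt (i+1)) ^ b) *
          (pih m (sig (i+1)) * pih m (tt i) ^ (k+1)) := by
      rw [← map_pow, ← map_mul, ← map_mul, ← mul_assoc ((tt i * tt (i+1)) ^ b),
        ← (hcen.zpow_right b).eq, hpow, hk, zpow_add]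
      congr 1
      have h1 := (hxy.pow_left (k+1)).zpow_right b
      rw [show ((k:ℤ)+1) = ((k+1 : ℕ) : ℤ) by push_cast; rfl, zpow_natCast,
        mul_assoc, mul_assoc, h1.eq, mul_assoc]
    rw [e]
    refine span_map_mem (LinearMap.mulLeft R (pih m ((tt i * tt (i+1)) ^ b))) _ _ ?_ st
    rintro z ⟨j, hj, h, hh, rfl⟩
    apply Submodule.subset_span
    refine ⟨b + j, b + ((k + 1 - j : ℕ) : ℤ), by omega, ?_, h, hh, ?_⟩
    · rcases Nat.eq_zero_or_pos j with rfl | hj0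
      · left; constructor <;> omega
      · right; simp only [abs_eq_max_neg]; omega
    · rw [LinearMap.mulLeft_apply, ← map_pow, ← map_pow, ← map_mul, ← mul_assoc, ← map_mul]
      congr 2
      rw [hpow, zpow_add, zpow_add, zpow_natCast, zpow_natCast]
      have := (hxy.symm.zpow_left b).pow_right j
      rw [mul_assoc, ← mul_assoc (tt (i+1) ^ b), this.eq]
      simp only [mul_assoc]

/-! ### The induction -/

/-- The sorting key: zero is minimal, nonzero integers in increasing order. -/
def key (e : ℕ) (x : ℤ) : ℕ := if x = 0 then 0 else (x + e + 1).toNat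

/-- Spanning set: elements of `Λ` times elements of `H_n(q)`. -/
def LS (M : ℕ) : Set (H M) :=
  {z | ∃ (l : ℕ) (k : Fin l → ℤ) (w : H M), l ≤ M + 1 ∧ (∀ j, k j ≠ 0) ∧ Antitone k ∧
    w ∈ HA M ∧ z = pih M (augWord l k) * w}

/-- The span of commutators. -/
noncomputable def CC (M : ℕ) : Submodule R (H M) :=
  Submodule.span R {x : H M | ∃ a b : H M, x = a * b - b * a}

lemma exists_split (a : ℕ → ℤ) (n : ℕ)
    (h : ∀ i j, i ≤ j → j < n → a i = 0 → a j = 0) :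
    ∃ l, l ≤ n ∧ (∀ j < l, a j ≠ 0) ∧ (∀ j, l ≤ j → j < n → a j = 0) := by
  classical
  by_cases hz : ∃ j, j < n ∧ a j = 0
  · refine ⟨Nat.find hz, (Nat.find_spec hz).1.le, ?_, ?_⟩
    · intro j hj h0
      exact Nat.find_min hz hj ⟨hj.trans (Nat.find_spec hz).1, h0⟩
    · intro j hj hjn
      exact h _ j hj hjn (Nat.find_spec hz).2
  · refine ⟨n, le_rfl, ?_, fun j h1 h2 => by omega⟩
    intro j hj h0
    exact hz ⟨j, hj, h0⟩

lemma sorted_mem (M e : ℕ) (a : ℕ → ℤ) (hb : ∀ j, j < M + 1 → (a j).natAbs ≤ e)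
    (hs : ∀ i, i < M → key e (a (i+1)) ≤ key e (a i)) (w : H M) (hw : w ∈ HA M) :
    pih M (PP a (M+1)) * w ∈ LS M := by
  have hmono : ∀ i j, i ≤ j → j < M + 1 → key e (a j) ≤ key e (a i) := by
    intro i j hij
    induction j, hij using Nat.le_induction with
    | base => intro _; exact le_rfl
    | succ j hij ih => intro hj; exact (hs j (by omega)).trans (ih (by omega))
  have hz : ∀ i j, i ≤ j → j < M + 1 → a i = 0 → a j = 0 := by
    intro i j hij hj h0
    have h1 := hmono i j hij hj
    have h2 := hb j hj
    by_contra h3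
    simp only [key, h0, h3, if_true, if_false] at h1
    omega
  obtain ⟨l, hl, hn, h0⟩ := exists_split a (M+1) hz
  refine ⟨l, fun j => a j, w, hl, fun j => hn j j.2, ?_, hw, ?_⟩
  · intro i j hij
    have h1 := hmono i j hij (by omega)
    have h2 := hb j (by omega)
    have h3 := hb i (by omega)
    simp only [key, hn j j.2, hn i i.2, if_false] at h1
    show a j ≤ a i
    omega
  · rw [augWord_eq, PP_zero l (M+1) hl h0]

/-- Energy. -/
def En (M : ℕ) (a : ℕ → ℤ) : ℕ := ∑ j ∈ range (M+1), (a j).natAbs ^ 2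

/-- Potential. -/
def Pot (M e : ℕ) (a : ℕ → ℤ) : ℕ := ∑ j ∈ range (M+1), j * key e (a j)

lemma En_sw_lt (M : ℕ) (a : ℕ → ℤ) (i : ℕ) (hi : i < M) (c d : ℤ)
    (hs : c + d = a i + a (i+1)) (hl : |c - d| < |a i - a (i+1)|) :
    En M (sw a i c d) < En M a := by
  have h := sum_sw (fun _ x => x.natAbs ^ 2) a i c d (M+1) (by omega)
  have h1 : c.natAbs ^ 2 + d.natAbs ^ 2 < (a i).natAbs ^ 2 + (a (i+1)).natAbs ^ 2 := by
    zify
    simp only [sq_abs]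
    have h2 := sq_lt_sq.2 hl
    have h3 : (c + d) ^ 2 = (a i + a (i+1)) ^ 2 := by rw [hs]
    nlinarith
  simp only [En]
  omega

lemma En_sw_eq (M : ℕ) (a : ℕ → ℤ) (i : ℕ) (hi : i < M) :
    En M (sw a i (a (i+1)) (a i)) = En M a := by
  have h := sum_sw (fun _ x => x.natAbs ^ 2) a i (a (i+1)) (a i) (M+1) (by omega)
  simp only [En]
  omega

lemma Pot_sw_lt (M e : ℕ) (a : ℕ → ℤ) (i : ℕ) (hi : i < M)
    (hk : key e (a i) < key e (a (i+1))) :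
    Pot M e (sw a i (a (i+1)) (a i)) < Pot M e a := by
  have h := sum_sw (fun j x => j * key e x) a i (a (i+1)) (a i) (M+1) (by omega)
  simp only [Pot]
  simp only [add_mul, one_mul] at h
  omega

lemma main_mem (M : ℕ) : ∀ (e p : ℕ) (a : ℕ → ℤ) (w : H M), w ∈ HA M → En M a = e →
    Pot M e a = p → pih M (PP a (M+1)) * w ∈ Submodule.span R (LS M) ⊔ CC M := by
  intro e
  induction e using Nat.strong_induction_on with
  | _ e ihe =>
  intro p
  induction p using Nat.strong_induction_on with
  | _ p ihp =>
  intro a w hw hE hP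
  by_cases hs : ∀ i, i < M → key e (a (i+1)) ≤ key e (a i)
  · apply Submodule.mem_sup_left
    apply Submodule.subset_span
    refine sorted_mem M e a ?_ hs w hw
    intro j hj
    have h1 : (a j).natAbs ^ 2 ≤ En M a :=
      single_le_sum (f := fun j => (a j).natAbs ^ 2) (fun _ _ => Nat.zero_le _) (mem_range.2 hj)
    rw [hE] at h1
    exact (Nat.le_self_pow (by norm_num) _).trans h1
  push Not at hs
  obtain ⟨i, hi, hk⟩ := hs
  have hne : a i ≠ a (i+1) := fun h => by rw [h] at hk; exact lt_irrefl _ hk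
  obtain ⟨s, hs, hst⟩ := straighten_xy hi (a i) (a (i+1)) hne
  have hsm : pih M s ∈ HA M ∧ pih M s⁻¹ ∈ HA M := by
    rcases hs with rfl | rfl
    · exact ⟨g_mem hi, g_inv_mem hi⟩
    · rw [inv_inv]; exact ⟨g_inv_mem hi, g_mem hi⟩
  have hsc : Commute s (PP (sw a i 0 0) (M+1)) := by
    rcases hs with rfl | rfl
    · exact sig_comm_PP a i (M+1) le_rfl
    · exact (sig_comm_PP a i (M+1) le_rfl).inv_left
  have hX : (PP a (M+1) : B M)
      = PP (sw a i 0 0) (M+1) * (tt i ^ a i * tt (i+1) ^ a (i+1)) := by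
    rw [← PP_sw a i (a i) (a (i+1)) (M+1) (by omega) le_rfl, sw_self]
  -- the conjugated element
  have hconj : pih M s * (pih M (PP a (M+1)) * w * pih M s⁻¹)
      ∈ Submodule.span R (LS M) ⊔ CC M := by
    have e1 : pih M s * (pih M (PP a (M+1)) * w * pih M s⁻¹)
        = pih M (PP (sw a i 0 0) (M+1)) * pih M (s * (tt i ^ a i * tt (i+1) ^ a (i+1)))
          * (w * pih M s⁻¹) := by
      rw [← map_mul, ← mul_assoc (PP (sw a i 0 0) (M+1)), ← hsc.eq, mul_assoc s, ← hX, map_mul]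
      simp only [mul_assoc]
    rw [e1]
    refine span_map_mem ((LinearMap.mulRight R (w * pih M s⁻¹)).comp
        (LinearMap.mulLeft R (pih M (PP (sw a i 0 0) (M+1))))) _ _ ?_ hst
    rintro z ⟨c, d, hcd, hor, h, hh, rfl⟩
    show pih M (PP (sw a i 0 0) (M+1)) * (pih M (tt i ^ c * tt (i+1) ^ d) * h)
      * (w * pih M s⁻¹) ∈ Submodule.span R (LS M) ⊔ CC M
    rw [← mul_assoc (pih M (PP (sw a i 0 0) (M+1))), ← map_mul,
      ← PP_sw a i c d (M+1) (by omega) le_rfl, mul_assoc]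
    have hw' : h * (w * pih M s⁻¹) ∈ HA M := mul_mem hh (mul_mem hw hsm.2)
    rcases hor with ⟨rfl, rfl⟩ | hlt
    · refine ihp _ ?_ _ _ hw' ?_ rfl
      · rw [← hP]; exact Pot_sw_lt M e a i hi hk
      · rw [En_sw_eq M a i hi, hE]
    · refine ihe _ ?_ _ _ _ hw' rfl rfl
      rw [← hE]; exact En_sw_lt M a i hi c d hcd hlt
  have hdiff : (pih M (PP a (M+1)) * w * pih M s⁻¹) * pih M s
      - pih M s * (pih M (PP a (M+1)) * w * pih M s⁻¹) ∈ Submodule.span R (LS M) ⊔ CC M :=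
    Submodule.mem_sup_right (Submodule.subset_span ⟨_, _, rfl⟩)
  have h2 := add_mem hdiff hconj
  have h3 : (pih M (PP a (M+1)) * w * pih M s⁻¹) * pih M s
      ∈ Submodule.span R (LS M) ⊔ CC M := by
    refine Eq.subst (motive := fun z => z ∈ Submodule.span R (LS M) ⊔ CC M) ?_ h2
    exact H_sub_add _ _
  rw [mul_assoc, g_inv_mul, mul_one] at h3
  exact h3

lemma order_aux (M mm : ℕ) (hmm : mm ≤ M) (k : Fin (mm+1) → ℤ)
    (w : H M) (hw : w ∈ HA M) :
    ∃ (N : ℕ) (ℓ : Fin N → ℕ) (kk : ∀ i, Fin (ℓ i) → ℤ) (wj : Fin N → H M),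
      (∀ i, ℓ i ≤ M + 1) ∧ (∀ i j, kk i j ≠ 0) ∧ (∀ i, Antitone (kk i)) ∧
      (∀ i, wj i ∈ HA M) ∧
      pih M (augWord (mm+1) k) * w - (∑ i, pih M (augWord (ℓ i) (kk i)) * wj i) ∈
        Submodule.span R {x : H M | ∃ a b : H M, x = a * b - b * a} := by
  let a : ℕ → ℤ := fun j => if h : j < mm + 1 then k ⟨j, h⟩ else 0
  have ha : (augWord (mm+1) k : B M) = PP a (M+1) := by
    rw [PP_zero (mm+1) (M+1) (by omega), ← augWord_eq]
    · congr 1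
      funext j
      simp only [a]
      rw [dif_pos j.2]
    · intro j h1 h2
      simp only [a]
      rw [dif_neg (by omega)]
  have hmem := main_mem M _ _ a w hw rfl rfl
  rw [← ha] at hmem
  obtain ⟨y, hy, z, hz, hyz⟩ := Submodule.mem_sup.1 hmem
  obtain ⟨N, f, g, hfg⟩ := Submodule.mem_span_set'.1 hy
  choose l kk wj h1 h2 h3 h4 h5 using fun i => (g i).2
  refine ⟨N, l, kk, fun i => f i • wj i, h1, h2, h3,
    fun i => Subalgebra.smul_mem _ (h4 i) _, ?_⟩
  have e : (∑ i, pih M (augWord (l i) (kk i)) * (f i • wj i)) = y := by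
    rw [← hfg]
    apply sum_congr rfl
    intro i _
    rw [h5 i, mul_smul_comm]
  rw [e, ← hyz]
  have h6 : y + z - y = z := add_sub_cancel_left y z
  rw [h6]
  exact hz

end Helpers

/-- **ordering the exponents.** For every `τ = t^{k_0}t_1^{k_1}⋯t_{mm}^{k_mm}`
in `Λ^{aug}` with `mm ≤ n−1` and every `w ∈ H_n(q)`, one has `τ·w ≐ Σ_j λ_j w_j` with
`λ_j ∈ Λ` and `w_j ∈ H_n(q)`, where `≐` is equality up to the span of commutators. -/
theorem order_the_exponents (M mm : ℕ) (hmm : mm ≤ M) (k : Fin (mm+1) → ℤ)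
    (hk : ∀ i, k i ≠ 0) (w : H M) (hw : w ∈ HA M) :
    ∃ (N : ℕ) (ℓ : Fin N → ℕ) (kk : ∀ i, Fin (ℓ i) → ℤ) (wj : Fin N → H M),
      (∀ i, ℓ i ≤ M + 1) ∧ (∀ i j, kk i j ≠ 0) ∧ (∀ i, Antitone (kk i)) ∧
      (∀ i, wj i ∈ HA M) ∧
      pih M (augWord (mm+1) k) * w - (∑ i, pih M (augWord (ℓ i) (kk i)) * wj i) ∈
        Submodule.span R {x : H M | ∃ a b : H M, x = a * b - b * a} := by
  exact order_aux M mm hmm k w hw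

end MB
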